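/- Let T > 0, let X_cstr, X_init, X_goal ⊆ ℝⁿ with X_goal contractible within X_cstr, and let F : ℝⁿ × [0,∞) → ℝⁿ be a continuous semiflow. Define the reachable tuple R = { (F(x,t), t) : x ∈ X_init, t ∈ [0,T] } and the augmented constrained set X̃_cstr = X_cstr × [0,T]. If there exists a loop in R that is not freely nullhomotopic within X̃_cstr (i.e., no continuous map H : [0,1] × [0,1] → X̃_cstr deforms it to a constant), then F cannot satisfy both the safety condition (F(x,t) ∈ X_cstr for all x ∈ X_init, t ∈ [0,T]) and the finite-time reachability condition (F(x,T) ∈ X_goal for all x ∈ X_init). -/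

import Mathlib

/-- A loop in a set `Y`: a continuous map `ℓ : [0,1] → Y` with `ℓ 0 = ℓ 1`
(modelled as a map `ℝ → E` restricted to `[0,1]`). -/
def IsLoopIn {E : Type*} [TopologicalSpace E] (ℓ : ℝ → E) (Y : Set E) : Prop :=
  ContinuousOn ℓ (Set.Icc 0 1) ∧ ℓ 0 = ℓ 1 ∧ ∀ s ∈ Set.Icc (0 : ℝ) 1, ℓ s ∈ Y

/-- A loop `ℓ` is freely nullhomotopic within `X`: there are a point `c ∈ X` and a
continuous map `H : [0,1] × [0,1] → X` with `H (s,0) = ℓ s` and `H (s,1) = c`. -/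
def FreelyNullhomotopicIn {E : Type*} [TopologicalSpace E] (ℓ : ℝ → E) (X : Set E) : Prop :=
  ∃ c ∈ X, ∃ H : ℝ → ℝ → E,
    ContinuousOn (fun p : ℝ × ℝ => H p.1 p.2) (Set.Icc 0 1 ×ˢ Set.Icc 0 1) ∧
    (∀ s ∈ Set.Icc (0 : ℝ) 1, ∀ t ∈ Set.Icc (0 : ℝ) 1, H s t ∈ X) ∧
    (∀ s ∈ Set.Icc (0 : ℝ) 1, H s 0 = ℓ s) ∧
    (∀ s ∈ Set.Icc (0 : ℝ) 1, H s 1 = c)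

/-- `Y` is contractible within `X`: every loop with image in `Y` is freely
nullhomotopic within `X`. -/
def ContractibleWithin {E : Type*} [TopologicalSpace E] (Y X : Set E) : Prop :=
  ∀ ℓ : ℝ → E, IsLoopIn ℓ Y → FreelyNullhomotopicIn ℓ X

/-- If `ℓ` is homotopic within `X` to `ℓ'`, and `ℓ'` is freely nullhomotopic within `X`,
then so is `ℓ`. -/
theorem FreelyNullhomotopicIn.of_homotopy {E : Type*} [TopologicalSpace E] {ℓ ℓ' : ℝ → E}
    {X : Set E} (K : ℝ → ℝ → E)
    (hK : ContinuousOn (fun p : ℝ × ℝ => K p.1 p.2) (Set.Icc 0 1 ×ˢ Set.Icc 0 1))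
    (hKX : ∀ s ∈ Set.Icc (0 : ℝ) 1, ∀ t ∈ Set.Icc (0 : ℝ) 1, K s t ∈ X)
    (hK0 : ∀ s ∈ Set.Icc (0 : ℝ) 1, K s 0 = ℓ s)
    (hK1 : ∀ s ∈ Set.Icc (0 : ℝ) 1, K s 1 = ℓ' s)
    (h : FreelyNullhomotopicIn ℓ' X) : FreelyNullhomotopicIn ℓ X := by
  obtain ⟨c, hc, G, hG, hGX, hG0, hG1⟩ := h
  have hsnd : ∀ s ∈ Set.Icc (0 : ℝ) 1, ∀ t, 1 / 2 ≤ t →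
      (if t ≤ 1 / 2 then K s (2 * t) else G s (2 * t - 1)) = G s (2 * t - 1) := by
    intro s hs t ht
    split_ifs with ht'
    · obtain rfl : t = 1 / 2 := le_antisymm ht' ht
      norm_num [hK1 s hs, hG0 s hs]
    · rfl
  refine ⟨c, hc, fun s t => if t ≤ 1 / 2 then K s (2 * t) else G s (2 * t - 1),
    ?_, ?_, ?_, ?_⟩
  · have hsplit : (Set.Icc 0 1 ×ˢ Set.Icc 0 1 : Set (ℝ × ℝ)) =
        Set.Icc 0 1 ×ˢ Set.Icc 0 (1 / 2) ∪ Set.Icc 0 1 ×ˢ Set.Icc (1 / 2) 1 := by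
      rw [← Set.prod_union, Set.Icc_union_Icc_eq_Icc (by norm_num) (by norm_num)]
    rw [hsplit]
    refine ContinuousOn.union_of_isClosed ?_ ?_ (isClosed_Icc.prod isClosed_Icc)
      (isClosed_Icc.prod isClosed_Icc)
    · refine (hK.comp (f := fun p : ℝ × ℝ => (p.1, 2 * p.2)) (by fun_prop) ?_).congr
        fun p hp => if_pos hp.2.2
      rintro ⟨s, t⟩ ⟨hs, ht⟩
      exact ⟨hs, by linarith [ht.1], by linarith [ht.2]⟩
    · refine (hG.comp (f := fun p : ℝ × ℝ => (p.1, 2 * p.2 - 1)) (by fun_prop) ?_).congr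
        fun p hp => hsnd p.1 hp.1 p.2 hp.2.1
      rintro ⟨s, t⟩ ⟨hs, ht⟩
      exact ⟨hs, by linarith [ht.1], by linarith [ht.2]⟩
  · intro s hs t ht
    dsimp only
    split_ifs with h
    · exact hKX s hs _ ⟨by linarith [ht.1], by linarith⟩
    · exact hGX s hs _ ⟨by linarith, by linarith [ht.2]⟩
  · intro s hs
    norm_num [hK0 s hs]
  · intro s hs
    norm_num [hG1 s hs]

/-- A nullhomotopy within `X` gives one within `X ×ˢ Y` at a constant second coordinate. -/
theorem FreelyNullhomotopicIn.prodMk_const {E E' : Type*} [TopologicalSpace E]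
    [TopologicalSpace E'] {ℓ : ℝ → E} {X : Set E} {Y : Set E'} {y : E'}
    (h : FreelyNullhomotopicIn ℓ X) (hy : y ∈ Y) :
    FreelyNullhomotopicIn (fun s => (ℓ s, y)) (X ×ˢ Y) := by
  obtain ⟨c, hc, H, hH, hHX, hH0, hH1⟩ := h
  exact ⟨(c, y), ⟨hc, hy⟩, fun s t => (H s t, y), hH.prodMk continuousOn_const,
    fun s hs t ht => ⟨hHX s hs t ht, hy⟩, fun s hs => by simp only [hH0 s hs],
    fun s hs => by simp only [hH1 s hs]⟩

/-- Theorem 1 of the paper, suboptimality of continuous policies: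
if some loop in the reachable tuple `R` of a continuous semiflow `F` is not freely
nullhomotopic within `X_cstr × [0,T]`, while `X_goal` is contractible within `X_cstr`,
then `F` cannot satisfy both the safety condition and finite-time reachability. -/
theorem noncontractible_reachable_tuple_infeasible {n : ℕ}
    (T : ℝ) (hT : 0 < T)
    (Xcstr Xinit Xgoal : Set (EuclideanSpace ℝ (Fin n)))
    (hgoal : ContractibleWithin Xgoal Xcstr)
    (F : EuclideanSpace ℝ (Fin n) × ℝ → EuclideanSpace ℝ (Fin n))
    (hFcont : ContinuousOn F (Set.univ ×ˢ Set.Ici (0 : ℝ)))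
    (hF0 : ∀ x : EuclideanSpace ℝ (Fin n), F (x, 0) = x)
    (hFadd : ∀ x : EuclideanSpace ℝ (Fin n), ∀ s t : ℝ, 0 ≤ s → 0 ≤ t →
      F (F (x, s), t) = F (x, s + t))
    (hloop : ∃ ℓ : ℝ → EuclideanSpace ℝ (Fin n) × ℝ,
      IsLoopIn ℓ {p : EuclideanSpace ℝ (Fin n) × ℝ |
        ∃ x ∈ Xinit, ∃ t ∈ Set.Icc (0 : ℝ) T, p = (F (x, t), t)} ∧
      ¬ FreelyNullhomotopicIn ℓ (Xcstr ×ˢ Set.Icc (0 : ℝ) T)) :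
    ¬ ((∀ x ∈ Xinit, ∀ t ∈ Set.Icc (0 : ℝ) T, F (x, t) ∈ Xcstr) ∧
       (∀ x ∈ Xinit, F (x, T) ∈ Xgoal)) := by
  rintro ⟨hsafe, hreach⟩
  obtain ⟨ℓ, ⟨hℓ, hℓ01, hℓR⟩, hnull⟩ := hloop
  have htime : ∀ s ∈ Set.Icc (0 : ℝ) 1, (ℓ s).2 ∈ Set.Icc (0 : ℝ) T := by
    intro s hs
    obtain ⟨x, -, t, ht, h⟩ := hℓR s hs
    rwa [h]
  have hflow : ∀ s ∈ Set.Icc (0 : ℝ) 1, ∃ x ∈ Xinit, ∀ r, 0 ≤ r →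
      F ((ℓ s).1, r) = F (x, (ℓ s).2 + r) := by
    intro s hs
    obtain ⟨x, hx, t, ht, h⟩ := hℓR s hs
    refine ⟨x, hx, fun r hr => ?_⟩
    rw [h]
    exact hFadd x t r ht.1 hr
  have hℓ' : ContinuousOn (fun p : ℝ × ℝ => ℓ p.1) (Set.Icc 0 1 ×ˢ Set.Icc 0 1) :=
    hℓ.comp continuousOn_fst fun p hp => hp.1
  have hscale : ContinuousOn (fun p : ℝ × ℝ => p.2 * (T - (ℓ p.1).2))
      (Set.Icc 0 1 ×ˢ Set.Icc 0 1) :=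
    continuousOn_snd.mul (continuousOn_const.sub hℓ'.snd)
  have hKcont : ContinuousOn
      (fun p : ℝ × ℝ => F ((ℓ p.1).1, p.2 * (T - (ℓ p.1).2))) (Set.Icc 0 1 ×ˢ Set.Icc 0 1) := by
    refine hFcont.comp (f := fun p : ℝ × ℝ => ((ℓ p.1).1, p.2 * (T - (ℓ p.1).2)))
      (hℓ'.fst.prodMk hscale) fun p hp => ⟨Set.mem_univ _, ?_⟩
    exact mul_nonneg hp.2.1 (sub_nonneg.2 (htime _ hp.1).2)
  refine hnull (FreelyNullhomotopicIn.of_homotopy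
    (ℓ' := fun s => (F ((ℓ s).1, T - (ℓ s).2), T))
    (fun s u => (F ((ℓ s).1, u * (T - (ℓ s).2)), (ℓ s).2 + u * (T - (ℓ s).2)))
    (hKcont.prodMk (hℓ'.snd.add hscale)) ?_ ?_ ?_ ((hgoal _ ⟨?_, ?_, ?_⟩).prodMk_const ⟨hT.le, le_rfl⟩))
  · intro s hs u hu
    obtain ⟨x, hx, hF⟩ := hflow s hs
    have hτ := htime s hs
    have h0 : 0 ≤ u * (T - (ℓ s).2) := mul_nonneg hu.1 (sub_nonneg.2 hτ.2)
    have h1 : u * (T - (ℓ s).2) ≤ T - (ℓ s).2 :=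
      mul_le_of_le_one_left (sub_nonneg.2 hτ.2) hu.2
    have hmem : (ℓ s).2 + u * (T - (ℓ s).2) ∈ Set.Icc (0 : ℝ) T :=
      ⟨add_nonneg hτ.1 h0, by linarith⟩
    refine ⟨?_, hmem⟩
    dsimp only
    rw [hF _ h0]
    exact hsafe x hx _ hmem
  · intro s hs
    simp [hF0]
  · intro s hs
    simp
  · have hend := hKcont.comp (f := fun s : ℝ => (s, (1 : ℝ))) (s := Set.Icc 0 1) (by fun_prop)
      fun s hs => ⟨hs, zero_le_one, le_rfl⟩
    simpa [Function.comp_def] using hend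
  · simp only [hℓ01]
  · intro s hs
    obtain ⟨x, hx, hF⟩ := hflow s hs
    rw [hF _ (sub_nonneg.2 (htime s hs).2), add_sub_cancel]
    exact hreach x hx
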